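/- Derivation of the fourth (sum) inequality of Theorem 1: Let S, T, K, W, U, V, Ŷ1, Ŷ2, Y11, Y12, Y21, Y22 be random variables with K = α∘S = β∘T almost surely for some functions α, β. Suppose there exist real numbers ρ0, ρ1, ρ2, r1, r2 with r1 ≥ 0, r2 ≥ 0, ρ0 > I[(S,T):W|K], ρ1 + ρ2 > I[(S,U):(T,V)|W] − I[S:T|W], H[S|(K,W)] + H[K] ≤ I[(S,U,W):(Ŷ2,Y11,Y12)] − r2 − ρ0 − ρ1, and H[T|(K,W)] + H[K] ≤ I[(T,V,W):(Ŷ1,Y21,Y22)] − r1 − ρ0 − ρ2. Then H[(S,T)] < I[(S,W,U):(Ŷ2,Y11,Y12)] + I[(T,W,V):(Ŷ1,Y21,Y22)] − I[(S,U):(T,V)|(K,W)] − I[(S,T):(K,W)]. -/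

import Mathlib

open MeasureTheory

namespace JSCC

variable {Ω : Type*} [MeasurableSpace Ω]

/-- Shannon entropy (natural log) of a finite-valued random variable. -/
noncomputable def H {A : Type*} [Fintype A] (μ : Measure Ω) (X : Ω → A) : ℝ :=
  ∑ a : A, Real.negMulLog (μ (X ⁻¹' {a})).toReal

/-- The pair of two random variables. -/
def p2 {A B : Type*} (X : Ω → A) (Y : Ω → B) : Ω → A × B := fun ω => (X ω, Y ω)

/-- The triple of three random variables. -/
def p3 {A B C : Type*} (X : Ω → A) (Y : Ω → B) (Z : Ω → C) : Ω → A × B × C :=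
  fun ω => (X ω, Y ω, Z ω)

/-- Conditional entropy `H[X|Y]`. -/
noncomputable def cH {A B : Type*} [Fintype A] [Fintype B] (μ : Measure Ω)
    (X : Ω → A) (Y : Ω → B) : ℝ :=
  H μ (p2 X Y) - H μ Y

/-- Mutual information `I[X:Y]`. -/
noncomputable def I {A B : Type*} [Fintype A] [Fintype B] (μ : Measure Ω)
    (X : Ω → A) (Y : Ω → B) : ℝ :=
  H μ X + H μ Y - H μ (p2 X Y)

/-- Conditional mutual information `I[X:Y|Z]`. -/
noncomputable def cI {A B C : Type*} [Fintype A] [Fintype B] [Fintype C] (μ : Measure Ω)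
    (X : Ω → A) (Y : Ω → B) (Z : Ω → C) : ℝ :=
  H μ (p2 X Z) + H μ (p2 Y Z) - H μ (p2 X (p2 Y Z)) - H μ Z

end JSCC

namespace JSCC

/-- Mutually inverse almost sure recodings are inverse to each other at values of positive
probability. -/
theorem leftInverse_of_ae_eq_comp {Ω A B : Type*} [MeasurableSpace Ω] {μ : Measure Ω}
    {X : Ω → A} {Y : Ω → B} {f : A → B} {g : B → A} (hf : ∀ᵐ ω ∂μ, Y ω = f (X ω))
    (hg : ∀ᵐ ω ∂μ, X ω = g (Y ω)) (a : A) (h : μ (X ⁻¹' {a}) ≠ 0) : g (f a) = a := by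
  by_contra hne
  refine h (measure_eq_zero_iff_ae_notMem.2 ?_)
  filter_upwards [hf, hg] with ω h₁ h₂ (h₃ : X ω = a)
  exact hne (by rw [← h₃, ← h₁, ← h₂])

theorem measure_preimage_ne_zero_of_negMulLog_ne_zero {Ω A : Type*} [MeasurableSpace Ω]
    {μ : Measure Ω} {X : Ω → A} {a : A}
    (h : Real.negMulLog (μ (X ⁻¹' {a})).toReal ≠ 0) : μ (X ⁻¹' {a}) ≠ 0 :=
  fun h0 => h (by simp [h0])

/-- Random variables that are almost surely functions of each other have the same entropy. -/
theorem H_eq_of_ae_eq_comp {Ω A B : Type*} [MeasurableSpace Ω] [Fintype A] [Fintype B]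
    {μ : Measure Ω} {X : Ω → A} {Y : Ω → B} (f : A → B) (g : B → A)
    (hf : ∀ᵐ ω ∂μ, Y ω = f (X ω)) (hg : ∀ᵐ ω ∂μ, X ω = g (Y ω)) : H μ X = H μ Y := by
  have measure_eq (a : A) (h : μ (X ⁻¹' {a}) ≠ 0) : μ (X ⁻¹' {a}) = μ (Y ⁻¹' {f a}) := by
    have hgf := leftInverse_of_ae_eq_comp hf hg a h
    refine measure_congr ?_
    filter_upwards [hf, hg] with ω h₁ h₂
    refine propext ⟨fun (h₃ : X ω = a) => ?_, fun (h₃ : Y ω = f a) => ?_⟩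
    · exact h₁.trans (congrArg f h₃)
    · exact h₂.trans ((congrArg g h₃).trans hgf)
  have measure_ne (b : B) (h : μ (Y ⁻¹' {b}) ≠ 0) : μ (X ⁻¹' {g b}) ≠ 0 := by
    have hfg := leftInverse_of_ae_eq_comp hg hf b h
    refine fun h0 => h (measure_eq_zero_iff_ae_notMem.2 ?_)
    filter_upwards [hg, measure_eq_zero_iff_ae_notMem.1 h0] with ω h₁ h₂ (h₃ : Y ω = b)
    exact h₂ (h₁.trans (congrArg g h₃))
  refine Finset.sum_bij_ne_zero (fun a _ _ => f a) (fun _ _ _ => Finset.mem_univ _) ?_ ?_ ?_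
  · intro a₁ _ h₁ a₂ _ h₂ h
    rw [← leftInverse_of_ae_eq_comp hf hg a₁ (measure_preimage_ne_zero_of_negMulLog_ne_zero h₁), h,
      leftInverse_of_ae_eq_comp hf hg a₂ (measure_preimage_ne_zero_of_negMulLog_ne_zero h₂)]
  · intro b _ hb
    have hb' := measure_preimage_ne_zero_of_negMulLog_ne_zero hb
    have hfg := leftInverse_of_ae_eq_comp hg hf b hb'
    refine ⟨g b, Finset.mem_univ _, ?_, hfg⟩
    rwa [measure_eq _ (measure_ne b hb'), hfg]
  · intro a _ h
    rw [measure_eq a (measure_preimage_ne_zero_of_negMulLog_ne_zero h)]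

/-- Pairing the conditioning variable with a function of `X` does not change the joint entropy. -/
theorem H_p2_p2_of_ae_eq {Ω A B C : Type*} [MeasurableSpace Ω] [Fintype A] [Fintype B]
    [Fintype C] {μ : Measure Ω} {X : Ω → A} {K : Ω → B} {W : Ω → C} (k : A → B)
    (hK : ∀ᵐ ω ∂μ, K ω = k (X ω)) : H μ (p2 X (p2 K W)) = H μ (p2 X W) :=
  H_eq_of_ae_eq_comp (fun x => (x.1, x.2.2)) (fun x => (x.1, k x.1, x.2))
    (.of_forall fun _ => rfl) (by filter_upwards [hK] with ω h; simp [p2, h])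

end JSCC

open JSCC

/-- Derivation of the fourth (sum) inequality of Theorem 1. -/
theorem fourth_inequality_of_theorem_one
    {Ω 𝒮 𝒯 𝒦 𝒲 𝒰 𝒱 𝒵₁ 𝒵₂ 𝒴₁₁ 𝒴₁₂ 𝒴₂₁ 𝒴₂₂ : Type*}
    [MeasurableSpace Ω]
    [Fintype 𝒮] [Nonempty 𝒮] [MeasurableSpace 𝒮] [MeasurableSingletonClass 𝒮]
    [Fintype 𝒯] [Nonempty 𝒯] [MeasurableSpace 𝒯] [MeasurableSingletonClass 𝒯]
    [Fintype 𝒦] [Nonempty 𝒦] [MeasurableSpace 𝒦] [MeasurableSingletonClass 𝒦]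
    [Fintype 𝒲] [Nonempty 𝒲] [MeasurableSpace 𝒲] [MeasurableSingletonClass 𝒲]
    [Fintype 𝒰] [Nonempty 𝒰] [MeasurableSpace 𝒰] [MeasurableSingletonClass 𝒰]
    [Fintype 𝒱] [Nonempty 𝒱] [MeasurableSpace 𝒱] [MeasurableSingletonClass 𝒱]
    [Fintype 𝒵₁] [Nonempty 𝒵₁] [MeasurableSpace 𝒵₁] [MeasurableSingletonClass 𝒵₁]
    [Fintype 𝒵₂] [Nonempty 𝒵₂] [MeasurableSpace 𝒵₂] [MeasurableSingletonClass 𝒵₂]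
    [Fintype 𝒴₁₁] [Nonempty 𝒴₁₁] [MeasurableSpace 𝒴₁₁] [MeasurableSingletonClass 𝒴₁₁]
    [Fintype 𝒴₁₂] [Nonempty 𝒴₁₂] [MeasurableSpace 𝒴₁₂] [MeasurableSingletonClass 𝒴₁₂]
    [Fintype 𝒴₂₁] [Nonempty 𝒴₂₁] [MeasurableSpace 𝒴₂₁] [MeasurableSingletonClass 𝒴₂₁]
    [Fintype 𝒴₂₂] [Nonempty 𝒴₂₂] [MeasurableSpace 𝒴₂₂] [MeasurableSingletonClass 𝒴₂₂]
    (μ : MeasureTheory.Measure Ω) [MeasureTheory.IsProbabilityMeasure μ]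
    (S : Ω → 𝒮)
    (T : Ω → 𝒯)
    (K : Ω → 𝒦)
    (W : Ω → 𝒲)
    (U : Ω → 𝒰)
    (V : Ω → 𝒱)
    (Yh₁ : Ω → 𝒵₁)
    (Yh₂ : Ω → 𝒵₂)
    (Y₁₁ : Ω → 𝒴₁₁)
    (Y₁₂ : Ω → 𝒴₁₂)
    (Y₂₁ : Ω → 𝒴₂₁)
    (Y₂₂ : Ω → 𝒴₂₂)
    (hS : Measurable S)
    (hT : Measurable T)
    (hK : Measurable K)
    (hW : Measurable W)
    (hU : Measurable U)
    (hV : Measurable V)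
    (hYh₁ : Measurable Yh₁)
    (hYh₂ : Measurable Yh₂)
    (hY₁₁ : Measurable Y₁₁)
    (hY₁₂ : Measurable Y₁₂)
    (hY₂₁ : Measurable Y₂₁)
    (hY₂₂ : Measurable Y₂₂)
    (α : 𝒮 → 𝒦) (β : 𝒯 → 𝒦)
    (hKα : ∀ᵐ ω ∂μ, K ω = α (S ω)) (hKβ : ∀ᵐ ω ∂μ, K ω = β (T ω))
    (ρ₀ ρ₁ ρ₂ r₁ r₂ : ℝ) (hr₁ : 0 ≤ r₁) (hr₂ : 0 ≤ r₂)
    (h1 : cI μ (p2 S T) W K < ρ₀)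
    (h2 : cI μ (p2 S U) (p2 T V) W - cI μ S T W < ρ₁ + ρ₂)
    (h3 : cH μ S (p2 K W) + H μ K ≤ I μ (p3 S U W) (p3 Yh₂ Y₁₁ Y₁₂) - r₂ - ρ₀ - ρ₁)
    (h4 : cH μ T (p2 K W) + H μ K ≤ I μ (p3 T V W) (p3 Yh₁ Y₂₁ Y₂₂) - r₁ - ρ₀ - ρ₂) :
    H μ (p2 S T) < I μ (p3 S W U) (p3 Yh₂ Y₁₁ Y₁₂) + I μ (p3 T W V) (p3 Yh₁ Y₂₁ Y₂₂)
      - cI μ (p2 S U) (p2 T V) (p2 K W) - I μ (p2 S T) (p2 K W) := by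
  have hKST : ∀ᵐ ω ∂μ, K ω = (α ∘ Prod.fst) (p2 S T ω) := hKα
  have hKSU : ∀ᵐ ω ∂μ, K ω = (α ∘ Prod.fst) (p2 S U ω) := hKα
  have hKTV : ∀ᵐ ω ∂μ, K ω = (β ∘ Prod.fst) (p2 T V ω) := hKβ
  have e_ST_K : H μ (p2 (p2 S T) K) = H μ (p2 S T) :=
    H_eq_of_ae_eq_comp Prod.fst (fun x => (x, α x.1)) (.of_forall fun _ => rfl)
      (by filter_upwards [hKα] with ω h; simp [p2, h])
  have e_WK : H μ (p2 W K) = H μ (p2 K W) :=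
    H_eq_of_ae_eq_comp Prod.swap Prod.swap (.of_forall fun _ => rfl) (.of_forall fun _ => rfl)
  have e_ST_WK : H μ (p2 (p2 S T) (p2 W K)) = H μ (p2 (p2 S T) (p2 K W)) :=
    H_eq_of_ae_eq_comp (Prod.map id Prod.swap) (Prod.map id Prod.swap)
      (.of_forall fun _ => rfl) (.of_forall fun _ => rfl)
  have e_S_TW : H μ (p2 S (p2 T W)) = H μ (p2 (p2 S T) W) :=
    H_eq_of_ae_eq_comp (fun x => ((x.1, x.2.1), x.2.2)) (fun x => (x.1.1, x.1.2, x.2))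
      (.of_forall fun _ => rfl) (.of_forall fun _ => rfl)
  have e_SU_TVKW : H μ (p2 (p2 S U) (p2 (p2 T V) (p2 K W))) =
      H μ (p2 (p2 S U) (p2 (p2 T V) W)) :=
    H_eq_of_ae_eq_comp (fun x => (x.1, x.2.1, x.2.2.2)) (fun x => (x.1, x.2.1, α x.1.1, x.2.2))
      (.of_forall fun _ => rfl) (by filter_upwards [hKα] with ω h; simp [p2, h])
  have e_SUW : H μ (p3 S U W) = H μ (p3 S W U) :=
    H_eq_of_ae_eq_comp (Prod.map id Prod.swap) (Prod.map id Prod.swap)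
      (.of_forall fun _ => rfl) (.of_forall fun _ => rfl)
  have e_TVW : H μ (p3 T V W) = H μ (p3 T W V) :=
    H_eq_of_ae_eq_comp (Prod.map id Prod.swap) (Prod.map id Prod.swap)
      (.of_forall fun _ => rfl) (.of_forall fun _ => rfl)
  have e_SUW_Y : H μ (p2 (p3 S U W) (p3 Yh₂ Y₁₁ Y₁₂)) = H μ (p2 (p3 S W U) (p3 Yh₂ Y₁₁ Y₁₂)) :=
    H_eq_of_ae_eq_comp (Prod.map (Prod.map id Prod.swap) id) (Prod.map (Prod.map id Prod.swap) id)
      (.of_forall fun _ => rfl) (.of_forall fun _ => rfl)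
  have e_TVW_Y : H μ (p2 (p3 T V W) (p3 Yh₁ Y₂₁ Y₂₂)) = H μ (p2 (p3 T W V) (p3 Yh₁ Y₂₁ Y₂₂)) :=
    H_eq_of_ae_eq_comp (Prod.map (Prod.map id Prod.swap) id) (Prod.map (Prod.map id Prod.swap) id)
      (.of_forall fun _ => rfl) (.of_forall fun _ => rfl)
  simp only [cI, I, cH, e_ST_K, e_WK, e_ST_WK, e_S_TW, e_SU_TVKW, e_SUW, e_TVW, e_SUW_Y, e_TVW_Y,
    H_p2_p2_of_ae_eq _ hKα, H_p2_p2_of_ae_eq _ hKβ, H_p2_p2_of_ae_eq _ hKST,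
    H_p2_p2_of_ae_eq _ hKSU, H_p2_p2_of_ae_eq _ hKTV] at h1 h2 h3 h4 ⊢
  linarith
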